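/- arXiv:cs/0106052 — 3 statements merged into one kernel-verified Lean document; each statement's English description precedes it below -/
import Mathlib

section
/- For every expression e, N(e) ≥ 2; and for all expressions t, s, if D(t, s) then N(t) > N(s). (Thus the level mapping |d(X,Y)| = N(X) strictly decreases from the first to the second argument on every atom d(t,s) in the least model of the derivative program, i.e., {d(t1,t2) | N(t1) > N(t2)} is a valid interargument relation.) -/
/-- Expressions built from u, numeric constants, +, * and der. -/
inductive Expr : Type
  | u : Expr
  | num : ℕ → Expr
  | add : Expr → Expr → Expr
  | mul : Expr → Expr → Expr
  | der : Expr → Expr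

/-- The norm N: N(u) = 2, N(num n) = 2, N(s+t) = max(N s, N t) + 1,
N(s*t) = max(N s, N t) + 1, N(der s) = 2^(N s). -/
def N : Expr → ℕ
  | Expr.u => 2
  | Expr.num _ => 2
  | Expr.add s t => max (N s) (N t) + 1
  | Expr.mul s t => max (N s) (N t) + 1
  | Expr.der s => 2 ^ N s

/-- The derivative relation D, defined by the clauses of the program. -/
inductive D : Expr → Expr → Prop
  | base : D (Expr.der Expr.u) (Expr.num 1)
  | number (n : ℕ) : D (Expr.der (Expr.num n)) (Expr.num 0)
  | add {X Y DX DY : Expr} : D (Expr.der X) DX → D (Expr.der Y) DY →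
      D (Expr.der (Expr.add X Y)) (Expr.add DX DY)
  | mul {X Y DX DY : Expr} : D (Expr.der X) DX → D (Expr.der Y) DY →
      D (Expr.der (Expr.mul X Y)) (Expr.add (Expr.mul X DY) (Expr.mul Y DX))
  | der {X DX DDX : Expr} : D (Expr.der X) DX → D (Expr.der DX) DDX →
      D (Expr.der (Expr.der X)) DDX

theorem two_le_N (e : Expr) : 2 ≤ N e := by
  induction e with
  | u => simp [N]
  | num n => simp [N]
  | add s t hs ht => simp only [N]; omega
  | mul s t hs ht => simp only [N]; omega
  | der s hs => exact hs.trans Nat.lt_two_pow_self.le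

theorem D.N_lt {t s : Expr} (h : D t s) : N s < N t := by
  induction h with
  | base => simp [N]
  | number n => simp [N]
  | @add X Y DX DY _ _ hX hY =>
    simp only [N] at hX hY ⊢
    have hXm : 2 ^ N X ≤ 2 ^ max (N X) (N Y) := by gcongr <;> simp
    have hYm : 2 ^ N Y ≤ 2 ^ max (N X) (N Y) := by gcongr <;> simp
    rw [pow_succ]
    omega
  | @mul X Y DX DY _ _ hX hY =>
    simp only [N] at hX hY ⊢
    have hXm : 2 ^ N X ≤ 2 ^ max (N X) (N Y) := by gcongr <;> simp
    have hYm : 2 ^ N Y ≤ 2 ^ max (N X) (N Y) := by gcongr <;> simp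
    have hXlt : N X < 2 ^ N X := Nat.lt_two_pow_self
    have hYlt : N Y < 2 ^ N Y := Nat.lt_two_pow_self
    have hX2 := two_le_N X
    rw [pow_succ]
    omega
  | @der X DX DDX _ _ hX hDX =>
    simp only [N] at hX hDX ⊢
    exact hDX.trans (Nat.pow_lt_pow_right one_lt_two hX)

/-- N e ≥ 2 for every expression e, and D t s implies N t > N s. -/
theorem stmt_6 :
    (∀ e : Expr, N e ≥ 2) ∧ (∀ t s : Expr, D t s → N t > N s) :=
  ⟨two_le_N, fun _ _ h => h.N_lt⟩
end

section
/- For every expression e, M(e) ≥ 2, and for all expressions a, b, c: M(a + b) > M(a), M(a + b) > M(b), M(a * (b + c)) > M((a * b) + (a * c)), and M((a + b) * c) > M((a * c) + (b * c)). (Hence the level mapping |dist(X,Y)| = M(X) strictly decreases from the head to each recursive body atom in every clause of the distributive-law program.) -/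
/-- Expressions built from the constant x and the binary operations + and *. -/
inductive E : Type
  | x : E
  | add : E → E → E
  | mul : E → E → E

/-- The norm M: M(x) = 2, M(s+t) = M s + M t + 1, M(s*t) = M s * M t. -/
def M : E → ℕ
  | E.x => 2
  | E.add s t => M s + M t + 1
  | E.mul s t => M s * M t

theorem two_le_M (e : E) : 2 ≤ M e := by
  induction e with
  | x => exact le_rfl
  | add s t hs ht => simp only [M]; omega
  | mul s t hs ht => simp only [M]; nlinarith

/-- M e ≥ 2 for every e, and the strict decreases of the
distributive-law program hold for M. -/
theorem stmt_8 :
    (∀ e : E, M e ≥ 2) ∧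
    (∀ a b : E, M (E.add a b) > M a) ∧
    (∀ a b : E, M (E.add a b) > M b) ∧
    (∀ a b c : E, M (E.mul a (E.add b c)) > M (E.add (E.mul a b) (E.mul a c))) ∧
    (∀ a b c : E, M (E.mul (E.add a b) c) > M (E.add (E.mul a c) (E.mul b c))) := by
  refine ⟨two_le_M, fun a b => ?_, fun a b => ?_, fun a b c => ?_, fun a b c => ?_⟩
  · simp only [M]; omega
  · simp only [M]; omega
  · simp only [M]; nlinarith [two_le_M a]
  · simp only [M]; nlinarith [two_le_M c]
end

section
/- Let > be a binary relation on lists over a type α such that (i) (a::l) > l for every element a and list l (subterm property in the second argument of cons), and (ii) l > l' implies (a::l) > (a::l') for every element a and lists l, l' (monotonicity in the second argument of cons). Then for all lists v, u, l, w and every element h: if Ap v (h::u) l and Ap v u w, then l > w. (This is the verification that M = {ap₂(a1,a2,a3), ap₁(b1,b2,b3) | a3 > b3} satisfies T_P'(M) ⊆ M for the unfolded conjunction of ap₂(V,[H|U],L) and ap₁(V,U,W), the decrease needed for termination of the permute program of Krishna Rao.) -/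
/-- The append relation: ap([],L,L) and ap([H|L1],L2,[H|L3]) ← ap(L1,L2,L3). -/
inductive Ap {α : Type*} : List α → List α → List α → Prop
  | nil (l : List α) : Ap [] l l
  | cons (h : α) {l1 l2 l3 : List α} : Ap l1 l2 l3 → Ap (h :: l1) l2 (h :: l3)

/-- if > has the subterm and monotonicity properties in the
second argument of cons, then Ap v (h::u) l and Ap v u w imply l > w. -/
theorem stmt_9 {α : Type*} (gt : List α → List α → Prop)
    (hsub : ∀ (a : α) (l : List α), gt (a :: l) l)
    (hmono : ∀ (a : α) (l l' : List α), gt l l' → gt (a :: l) (a :: l')) :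
    ∀ (v u l w : List α) (h : α), Ap v (h :: u) l → Ap v u w → gt l w := by
  intro v
  induction v with
  | nil =>
    rintro u l w h ⟨⟩ ⟨⟩
    exact hsub h u
  | cons a v ih =>
    rintro u l w h (_ | ⟨_, h₁⟩) (_ | ⟨_, h₂⟩)
    exact hmono a _ _ (ih u _ _ h h₁ h₂)
end
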